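/- In U_q(sp_{2n}) the matrix S = T J T̄^u satisfies: (i) s_{ij} = 0 for 1 ≤ i < j ≤ 2n; (ii) s_{ii} = ε_i for 1 ≤ i ≤ 2n; (iii) the reflection equation R S₁ R^u S₂ = S₂ R^u S₁ R, where S₁ = Σ_{i,j} e_{ij} ⊗ I ⊗ s_{ij} and S₂ = Σ_{i,j} I ⊗ e_{ij} ⊗ s_{ij} (an entrywise identity in U_q(sp_{2n})); and (iv) S̄ D^{−1} S D = −I. -/

import Mathlib

noncomputable section

set_option synthInstance.maxHeartbeats 1000000
set_option maxHeartbeats 1000000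

namespace CI

/-- The ground field F = ℂ(q). -/
abbrev F : Type := RatFunc ℂ

/-- The formal variable q. -/
def q : F := RatFunc.X

/-- The index involution i ↦ i′ = 2n+1−i (here in 0-based form i ↦ 2n−1−i). -/
def pr (n : ℕ) (i : Fin (2*n)) : Fin (2*n) := ⟨2*n - 1 - i.val, by have := i.isLt; omega⟩

/-- ε_i = 1 for i ≤ n and ε_i = −1 for i > n (1-based). -/
def eps (n : ℕ) (i : Fin (2*n)) : F := if (i : ℕ) < n then 1 else -1

/-- (1̄,…,n̄,(n+1)̄,…,(2n)̄) = (n,…,1,−1,…,−n). -/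
def bar (n : ℕ) (i : Fin (2*n)) : ℤ :=
  if (i : ℕ) < n then (n : ℤ) - (i : ℕ) else (n : ℤ) - (i : ℕ) - 1

/-- The diagonal entries of D = diag(qⁿ,…,q,q⁻¹,…,q⁻ⁿ): D_{ii} = q^{ī}. -/
def dd (n : ℕ) (i : Fin (2*n)) : F := q ^ (bar n i)

/-- The entries of the R-matrix R = Σ_{i,j} q^{δ_{ij}−δ_{ij′}} e_{ii} ⊗ e_{jj}
    + (q−q⁻¹) Σ_{i<j} e_{ij} ⊗ e_{ji}
    − (q−q⁻¹) Σ_{i<j} q^{j̄−ī} ε_i ε_j e_{ij} ⊗ e_{i′j′}. -/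
def Rm (n : ℕ) (p s : Fin (2*n) × Fin (2*n)) : F :=
  (if p.1 = s.1 ∧ p.2 = s.2 then
      q ^ ((if p.1 = p.2 then (1:ℤ) else 0) - (if p.1 = pr n p.2 then (1:ℤ) else 0)) else 0)
  + (if p.1 < p.2 ∧ s.1 = p.2 ∧ s.2 = p.1 then q - q⁻¹ else 0)
  - (if p.1 < s.1 ∧ p.2 = pr n p.1 ∧ s.2 = pr n s.1 then
      (q - q⁻¹) * q ^ (bar n s.1 - bar n p.1) * eps n p.1 * eps n s.1 else 0)

/-- Generators t_{ij}, t̄_{ij} of the extended algebra. -/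
inductive Gen (n : ℕ) : Type
  | t (i j : Fin (2*n)) : Gen n
  | tb (i j : Fin (2*n)) : Gen n

/-- The free F-algebra on the generators. -/
abbrev FA (n : ℕ) : Type := FreeAlgebra F (Gen n)

def tF (n : ℕ) (i j : Fin (2*n)) : FA n := FreeAlgebra.ι F (Gen.t i j)
def tbF (n : ℕ) (i j : Fin (2*n)) : FA n := FreeAlgebra.ι F (Gen.tb i j)

/-- The defining relations of the RTT presentation U_q(sp_{2n}): the triangularity
    and diagonal relations, the entrywise RTT relations R T₁ T₂ = T₂ T₁ R,
    R T̄₁ T̄₂ = T̄₂ T̄₁ R, R T̄₁ T₂ = T₂ T̄₁ R, and the entrywise central relations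
    T D Tᵗ D⁻¹ = T̄ D T̄ᵗ D⁻¹ = I, D Tᵗ D⁻¹ T = D T̄ᵗ D⁻¹ T̄ = I
    (where ᵗ is the twisted transposition e_{ij}ᵗ = ε_i ε_j e_{j′i′}). -/
inductive rel (n : ℕ) : FA n → FA n → Prop
  | t_upper (i j : Fin (2*n)) (h : i < j) : rel n (tF n i j) 0
  | tb_lower (i j : Fin (2*n)) (h : j < i) : rel n (tbF n i j) 0
  | t_tb_diag (i : Fin (2*n)) : rel n (tF n i i * tbF n i i) 1
  | tb_t_diag (i : Fin (2*n)) : rel n (tbF n i i * tF n i i) 1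
  | rtt_tt (i a j b : Fin (2*n)) :
      rel n (∑ k, ∑ c, Rm n (i, a) (k, c) • (tF n k j * tF n c b))
            (∑ c, ∑ l, Rm n (l, c) (j, b) • (tF n a c * tF n i l))
  | rtt_bb (i a j b : Fin (2*n)) :
      rel n (∑ k, ∑ c, Rm n (i, a) (k, c) • (tbF n k j * tbF n c b))
            (∑ c, ∑ l, Rm n (l, c) (j, b) • (tbF n a c * tbF n i l))
  | rtt_bt (i a j b : Fin (2*n)) :
      rel n (∑ k, ∑ c, Rm n (i, a) (k, c) • (tbF n k j * tF n c b))
            (∑ c, ∑ l, Rm n (l, c) (j, b) • (tF n a c * tbF n i l))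
  | cent_t1 (i j : Fin (2*n)) :
      rel n (∑ k, (dd n k * (dd n j)⁻¹ * eps n (pr n k) * eps n (pr n j)) •
              (tF n i k * tF n (pr n j) (pr n k)))
            (if i = j then 1 else 0)
  | cent_tb1 (i j : Fin (2*n)) :
      rel n (∑ k, (dd n k * (dd n j)⁻¹ * eps n (pr n k) * eps n (pr n j)) •
              (tbF n i k * tbF n (pr n j) (pr n k)))
            (if i = j then 1 else 0)
  | cent_t2 (i j : Fin (2*n)) :
      rel n (∑ k, (dd n i * (dd n k)⁻¹ * eps n (pr n i) * eps n (pr n k)) •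
              (tF n (pr n k) (pr n i) * tF n k j))
            (if i = j then 1 else 0)
  | cent_tb2 (i j : Fin (2*n)) :
      rel n (∑ k, (dd n i * (dd n k)⁻¹ * eps n (pr n i) * eps n (pr n k)) •
              (tbF n (pr n k) (pr n i) * tbF n k j))
            (if i = j then 1 else 0)

/-- The RTT presentation U_q(sp_{2n}). -/
abbrev Usp (n : ℕ) : Type := RingQuot (rel n)

/-- The generator t_{ij} of U_q(sp_{2n}). -/
def tU (n : ℕ) (i j : Fin (2*n)) : Usp n := RingQuot.mkAlgHom F (rel n) (tF n i j)

/-- The generator t̄_{ij} of U_q(sp_{2n}). -/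
def tbU (n : ℕ) (i j : Fin (2*n)) : Usp n := RingQuot.mkAlgHom F (rel n) (tbF n i j)

/-- The entries s_{ij} = Σ_{k=j}^{i} ε_k t_{ik} t̄_{jk} of the matrix S = T J T̄^u. -/
def sU (n : ℕ) (i j : Fin (2*n)) : Usp n :=
  ∑ k ∈ Finset.Icc j i, eps n k • (tU n i k * tbU n j k)

/-- The entries s̄_{ij} = ε_i ε_j Σ_{k=j}^{i} ε_{k′} t̄_{i′k′} t_{j′k′} of the
    matrix S̄ = T̄^{ut} Jᵗ Tᵗ. -/
def sbU (n : ℕ) (i j : Fin (2*n)) : Usp n :=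
  (eps n i * eps n j) • ∑ k ∈ Finset.Icc j i,
    eps n (pr n k) • (tbU n (pr n i) (pr n k) * tU n (pr n j) (pr n k))

/-- The twisted quantized enveloping algebra U_q^{tw}(gl_n): the subalgebra of
    U_q(sp_{2n}) generated by the entries of S. -/
def Utw (n : ℕ) : Subalgebra F (Usp n) :=
  Algebra.adjoin F (Set.range fun p : Fin (2*n) × Fin (2*n) => sU n p.1 p.2)

/-- The entries of R^u, the partial transpose of R in the first tensor factor. -/
def Rum (n : ℕ) (p s : Fin (2*n) × Fin (2*n)) : F := Rm n (s.1, p.2) (p.1, s.2)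

section Abstract
variable {K U I : Type} [Field K] [Ring U] [Algebra K U] [Fintype I] [DecidableEq I]

/-- `M ⊗ I`. -/
def E1 (M : Matrix I I U) : Matrix (I × I) (I × I) U :=
  Matrix.of fun p s => if p.2 = s.2 then M p.1 s.1 else 0

/-- `I ⊗ M`. -/
def E2 (M : Matrix I I U) : Matrix (I × I) (I × I) U :=
  Matrix.of fun p s => if p.1 = s.1 then M p.2 s.2 else 0

/-- Scalar matrix. -/
def Cm (U : Type) [Ring U] [Algebra K U] (r : I × I → I × I → K) : Matrix (I × I) (I × I) U :=
  Matrix.of fun p s => algebraMap K U (r p s)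

lemma Cm_apply (r : I × I → I × I → K) (p s : I × I) :
    Cm U r p s = algebraMap K U (r p s) := rfl

lemma E1_mul (M N : Matrix I I U) : E1 (M * N) = E1 M * E1 N := by
  ext ⟨i, a⟩ ⟨j, b⟩
  simp only [E1, Matrix.of_apply, Matrix.mul_apply, Fintype.sum_prod_type]
  by_cases h : a = b
  · subst h; simp
  · simp [h]

lemma E2_mul (M N : Matrix I I U) : E2 (M * N) = E2 M * E2 N := by
  ext ⟨i, a⟩ ⟨j, b⟩
  simp only [E2, Matrix.of_apply, Matrix.mul_apply, Fintype.sum_prod_type]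
  by_cases h : i = j
  · subst h; simp
  · simp [h]

lemma E1E2 (M N : Matrix I I U) (i a j b : I) : (E1 M * E2 N) (i, a) (j, b) = M i j * N a b := by
  simp [E1, E2, Matrix.mul_apply, Fintype.sum_prod_type]

lemma E2E1 (M N : Matrix I I U) (i a j b : I) : (E2 N * E1 M) (i, a) (j, b) = N a b * M i j := by
  simp [E1, E2, Matrix.mul_apply, Fintype.sum_prod_type]

lemma C_E1E2 (r : I × I → I × I → K) (M N : Matrix I I U) (i a j b : I) :
    (Cm U r * (E1 M * E2 N)) (i, a) (j, b) = ∑ k, ∑ c, r (i, a) (k, c) • (M k j * N c b) := by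
  rw [Matrix.mul_apply]
  simp only [E1E2, Cm, Matrix.of_apply, Fintype.sum_prod_type, Algebra.smul_def]

lemma E2E1_C (r : I × I → I × I → K) (M N : Matrix I I U) (i a j b : I) :
    (E2 N * E1 M * Cm U r) (i, a) (j, b) = ∑ c, ∑ l, r (l, c) (j, b) • (N a c * M i l) := by
  rw [Matrix.mul_apply]
  simp only [E2E1, Cm_apply, Fintype.sum_prod_type, Algebra.smul_def]
  rw [Finset.sum_comm]
  simp only [Algebra.commutes]

lemma E1_C (r : I × I → I × I → K) (M : Matrix I I U) (i a j b : I) :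
    (E1 M * Cm U r) (i, a) (j, b) = ∑ k, r (k, a) (j, b) • M i k := by
  simp [E1, Cm, Matrix.mul_apply, Fintype.sum_prod_type, Algebra.smul_def, Algebra.commutes]

lemma E2_C (r : I × I → I × I → K) (M : Matrix I I U) (i a j b : I) :
    (E2 M * Cm U r) (i, a) (j, b) = ∑ c, r (i, c) (j, b) • M a c := by
  simp [E2, Cm, Matrix.mul_apply, Fintype.sum_prod_type, Algebra.smul_def, Algebra.commutes]

lemma E1_C_E2 (r : I × I → I × I → K) (M N : Matrix I I U) (i a j b : I) :
    (E1 M * Cm U r * E2 N) (i, a) (j, b) = ∑ k, ∑ c, r (k, a) (j, c) • (M i k * N c b) := by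
  rw [Matrix.mul_apply]
  simp only [E1_C, Fintype.sum_prod_type]
  simp only [E2, Matrix.of_apply, mul_ite, mul_zero]
  rw [Finset.sum_comm]
  simp [Finset.sum_mul]
  rw [Finset.sum_comm]

lemma E2_C_E1 (r : I × I → I × I → K) (M N : Matrix I I U) (i a j b : I) :
    (E2 N * Cm U r * E1 M) (i, a) (j, b) = ∑ c, ∑ k, r (i, c) (k, b) • (N a c * M k j) := by
  rw [Matrix.mul_apply]
  simp only [E2_C, Fintype.sum_prod_type]
  simp only [E1, Matrix.of_apply, mul_ite, mul_zero]
  simp [Finset.sum_mul]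
  rw [Finset.sum_comm]

lemma lhs_entry (r r' : I × I → I × I → K) (S : Matrix I I U) (i a j b : I) :
    (Cm U r * (E1 S * Cm U r' * E2 S)) (i, a) (j, b) =
      ∑ k, ∑ c, ∑ l, ∑ e, (r (i, a) (k, c) * r' (l, c) (j, e)) • (S k l * S e b) := by
  rw [Matrix.mul_apply]
  simp only [E1_C_E2, Fintype.sum_prod_type, Cm_apply, ← Algebra.smul_def,
    Finset.smul_sum, smul_smul]

lemma rhs_entry (r r' : I × I → I × I → K) (S : Matrix I I U) (i a j b : I) :
    (E2 S * Cm U r' * E1 S * Cm U r) (i, a) (j, b) =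
      ∑ c, ∑ l, ∑ d, ∑ m, (r' (i, c) (l, d) * r (m, d) (j, b)) • (S a c * S l m) := by
  rw [Matrix.mul_apply]
  simp only [E2_C_E1, Fintype.sum_prod_type, Cm_apply, ← Algebra.commutes (R := K),
    ← Algebra.smul_def, Finset.smul_sum, smul_smul]
  rw [Finset.sum_congr rfl fun m _ => Finset.sum_comm]
  rw [Finset.sum_comm]
  refine Finset.sum_congr rfl fun c _ => ?_
  rw [Finset.sum_congr rfl fun m _ => Finset.sum_comm]
  rw [Finset.sum_comm]
  refine Finset.sum_congr rfl fun l _ => ?_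
  rw [Finset.sum_comm]
  simp only [mul_comm]

lemma E_comm_diag1 (e : I → K) (M : Matrix I I U) :
    E1 (Matrix.diagonal fun k => algebraMap K U (e k)) * E2 M
      = E2 M * E1 (Matrix.diagonal fun k => algebraMap K U (e k)) := by
  ext ⟨i, a⟩ ⟨j, b⟩
  rw [E1E2, E2E1]
  by_cases h : i = j
  · subst h; simp [Algebra.commutes]
  · simp [h]

lemma E_comm_diag2 (e : I → K) (M : Matrix I I U) :
    E2 (Matrix.diagonal fun k => algebraMap K U (e k)) * E1 M
      = E1 M * E2 (Matrix.diagonal fun k => algebraMap K U (e k)) := by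
  ext ⟨i, a⟩ ⟨j, b⟩
  rw [E1E2, E2E1]
  by_cases h : a = b
  · subst h; simp [Algebra.commutes]
  · simp [h]

/-- The reflection equation from the RTT relations. -/
theorem reflection (r ru : I × I → I × I → K) (e : I → K) (t tb : Matrix I I U)
    (hru : ∀ p s, ru p s = r (s.1, p.2) (p.1, s.2))
    (hsym : ∀ i a k c, r (i, a) (k, c) = r (c, k) (a, i))
    (htt : ∀ i a j b, ∑ k, ∑ c, r (i, a) (k, c) • (t k j * t c b)
      = ∑ c, ∑ l, r (l, c) (j, b) • (t a c * t i l))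
    (hbb : ∀ i a j b, ∑ k, ∑ c, r (i, a) (k, c) • (tb k j * tb c b)
      = ∑ c, ∑ l, r (l, c) (j, b) • (tb a c * tb i l))
    (hbt : ∀ i a j b, ∑ k, ∑ c, r (i, a) (k, c) • (tb k j * t c b)
      = ∑ c, ∑ l, r (l, c) (j, b) • (t a c * tb i l))
    (hJ : ∀ i a j b, ∑ k, ∑ c, r (i, a) (k, c) * e k * ru (k, c) (j, b) * e b
      = ∑ k, ∑ c, e a * ru (i, a) (k, c) * e k * r (k, c) (j, b))
    (S : Matrix I I U)
    (hS : S = t * (Matrix.diagonal fun k => algebraMap K U (e k)) * tb.transpose) :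
    Cm U r * (E1 S * Cm U ru * E2 S) = E2 S * Cm U ru * E1 S * Cm U r := by
  set J : Matrix I I U := Matrix.diagonal fun k => algebraMap K U (e k) with hJdef
  have a1 : Cm U r * (E1 t * E2 t) = E2 t * E1 t * Cm U r := by
    ext ⟨i, a⟩ ⟨j, b⟩
    rw [C_E1E2, E2E1_C, htt]
  have a2 : E1 tb.transpose * Cm U ru * E2 t = E2 t * Cm U ru * E1 tb.transpose := by
    ext ⟨i, a⟩ ⟨j, b⟩
    rw [E1_C_E2, E2_C_E1]
    simp only [hru, Matrix.transpose_apply]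
    exact hbt j a i b
  have a3 : Cm U r * (E1 tb.transpose * E2 tb.transpose)
      = E2 tb.transpose * E1 tb.transpose * Cm U r := by
    ext ⟨i, a⟩ ⟨j, b⟩
    rw [C_E1E2, E2E1_C]
    simp only [Matrix.transpose_apply]
    have := hbb b j a i
    rw [Finset.sum_comm] at this
    rw [Finset.sum_comm (f := fun c l => r (l, c) (j, b) • (tb c a * tb l i))]
    simp only [hsym i a, hsym _ _ j b]
    rw [← this, Finset.sum_comm]
  have a4 : E1 t * Cm U ru * E2 tb.transpose = E2 tb.transpose * Cm U ru * E1 t := by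
    ext ⟨i, a⟩ ⟨j, b⟩
    rw [E1_C_E2, E2_C_E1]
    simp only [hru, Matrix.transpose_apply]
    have := hbt b i a j
    simp only [hsym j a, hsym _ _ i b]
    exact this.symm
  have a5 : Cm U r * E1 J * Cm U ru * E2 J = E2 J * Cm U ru * E1 J * Cm U r := by
    ext ⟨i, a⟩ ⟨j, b⟩
    have := congrArg (algebraMap K U) (hJ i a j b)
    have h1 : ∀ i a j b, (Cm U r * E1 J : Matrix (I × I) (I × I) U) (i, a) (j, b)
        = algebraMap K U (r (i, a) (j, b) * e j) := by
      intro i a j b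
      simp [Cm, E1, hJdef, Matrix.mul_apply, Fintype.sum_prod_type, Matrix.diagonal_apply]
    have h2 : ∀ i a j b, (E2 J * Cm U ru : Matrix (I × I) (I × I) U) (i, a) (j, b)
        = algebraMap K U (e a * ru (i, a) (j, b)) := by
      intro i a j b
      simp [Cm, E2, hJdef, Matrix.mul_apply, Fintype.sum_prod_type, Matrix.diagonal_apply]
    have h3 : ∀ i a j b, (Cm U r * E1 J * Cm U ru : Matrix (I × I) (I × I) U) (i, a) (j, b)
        = ∑ k, ∑ c, algebraMap K U (r (i, a) (k, c) * e k * ru (k, c) (j, b)) := by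
      intro i a j b
      rw [Matrix.mul_apply]
      simp only [h1, Fintype.sum_prod_type, Cm_apply, map_mul]
    have h4 : ∀ i a j b, (E2 J * Cm U ru * E1 J : Matrix (I × I) (I × I) U) (i, a) (j, b)
        = algebraMap K U (e a * ru (i, a) (j, b) * e j) := by
      intro i a j b
      rw [Matrix.mul_apply]
      simp only [h2, Fintype.sum_prod_type]
      simp [E1, hJdef, Matrix.diagonal_apply]
    calc _ = algebraMap K U (∑ k, ∑ c, r (i, a) (k, c) * e k * ru (k, c) (j, b) * e b) := by
          rw [Matrix.mul_apply]
          simp only [h3, Fintype.sum_prod_type]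
          simp [E2, hJdef, Matrix.diagonal_apply, Finset.sum_mul]
      _ = _ := this
      _ = _ := by
          rw [Matrix.mul_apply (M := E2 J * Cm U ru * E1 J)]
          simp only [h4, Fintype.sum_prod_type, Cm_apply, map_mul, map_sum]
  have c1 : ∀ M : Matrix I I U, E1 J * E2 M = E2 M * E1 J := E_comm_diag1 e
  have c2 : ∀ M : Matrix I I U, E2 J * E1 M = E1 M * E2 J := E_comm_diag2 e
  have s1 : E1 S = E1 t * E1 J * E1 tb.transpose := by rw [hS, E1_mul, E1_mul]
  have s2 : E2 S = E2 t * E2 J * E2 tb.transpose := by rw [hS, E2_mul, E2_mul]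
  rw [s1, s2]
  calc _ = Cm U r * E1 t * E1 J * (E1 tb.transpose * Cm U ru * E2 t) * E2 J * E2 tb.transpose := by
        noncomm_ring
    _ = Cm U r * E1 t * (E1 J * E2 t) * Cm U ru * (E1 tb.transpose * E2 J) * E2 tb.transpose := by
        rw [a2]; noncomm_ring
    _ = (Cm U r * (E1 t * E2 t)) * E1 J * Cm U ru * E2 J * (E1 tb.transpose * E2 tb.transpose) := by
        rw [c1, ← c2]; noncomm_ring
    _ = E2 t * E1 t * (Cm U r * E1 J * Cm U ru * E2 J) * (E1 tb.transpose * E2 tb.transpose) := by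
        rw [a1]; noncomm_ring
    _ = E2 t * E1 t * E2 J * Cm U ru * E1 J * (Cm U r * (E1 tb.transpose * E2 tb.transpose)) := by
        rw [a5]; noncomm_ring
    _ = E2 t * (E1 t * E2 J) * Cm U ru * (E1 J * E2 tb.transpose) * E1 tb.transpose * Cm U r := by
        rw [a3]; noncomm_ring
    _ = E2 t * E2 J * (E1 t * Cm U ru * E2 tb.transpose) * E1 J * E1 tb.transpose * Cm U r := by
        rw [c1, ← c2]; noncomm_ring
    _ = _ := by rw [a4]; noncomm_ring

lemma neg_one_smul_one (K U : Type) [Field K] [Ring U] [Algebra K U] :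
    (-1 : K) • (1 : U) = -1 := by simp

end Abstract

section Scalars
variable {n : ℕ}

lemma q_ne : q ≠ 0 := RatFunc.X_ne_zero

lemma pr_pr (i : Fin (2*n)) : pr n (pr n i) = i := by
  ext; have := i.isLt; simp only [pr]; omega

lemma pr_lt (i j : Fin (2*n)) : pr n i < pr n j ↔ j < i := by
  simp only [pr, Fin.lt_def]; have := i.isLt; have := j.isLt; omega

lemma pr_ne (i : Fin (2*n)) : pr n i ≠ i := by
  simp only [pr, ne_eq, Fin.ext_iff]; have := i.isLt; omega

lemma eps_pr (i : Fin (2*n)) : eps n (pr n i) = - eps n i := by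
  have := i.isLt
  unfold eps
  have h : ((pr n i : Fin (2*n)) : ℕ) < n ↔ ¬ (i : ℕ) < n := by simp only [pr]; omega
  by_cases h' : (i : ℕ) < n
  · rw [if_neg (by rw [h]; exact not_not.2 h'), if_pos h']
  · rw [if_pos (h.2 h'), if_neg h', neg_neg]

lemma bar_pr (i : Fin (2*n)) : bar n (pr n i) = - bar n i := by
  have := i.isLt
  simp only [bar, pr]
  split_ifs <;> omega

lemma dd_pr (i : Fin (2*n)) : dd n (pr n i) = (dd n i)⁻¹ := by
  simp [dd, bar_pr]

lemma dd_ne (i : Fin (2*n)) : dd n i ≠ 0 := zpow_ne_zero _ q_ne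

lemma eps_sq (i : Fin (2*n)) : eps n i * eps n i = 1 := by
  unfold eps; split_ifs <;> simp

lemma pr_eq (i j : Fin (2*n)) : pr n i = j ↔ i = pr n j := by
  exact ⟨fun h => by rw [← h, pr_pr], fun h => by rw [h, pr_pr]⟩

/-- Diagonal coefficient. -/
def Dc (n : ℕ) (i a : Fin (2*n)) : F :=
  q ^ ((if i = a then (1:ℤ) else 0) - (if i = pr n a then (1:ℤ) else 0))

/-- Coefficient of the third term. -/
def Kc (n : ℕ) (i k : Fin (2*n)) : F :=
  (q - q⁻¹) * q ^ (bar n k - bar n i) * eps n i * eps n k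

lemma Rm_eq (i a k c : Fin (2*n)) : Rm n (i, a) (k, c) =
    (if i = k ∧ a = c then Dc n i a else 0)
    + (if i < a ∧ k = a ∧ c = i then q - q⁻¹ else 0)
    - (if i < k ∧ a = pr n i ∧ c = pr n k then Kc n i k else 0) := rfl

lemma Dc_comm (i a : Fin (2*n)) : Dc n i a = Dc n a i := by
  unfold Dc
  have h : i = pr n a ↔ a = pr n i := by rw [← pr_eq]; exact eq_comm
  simp only [eq_comm (a := i) (b := a), h]

lemma Dc_pr (i : Fin (2*n)) : Dc n i (pr n i) = q⁻¹ := by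
  unfold Dc
  rw [if_neg (pr_ne i).symm, if_pos (pr_pr i).symm]
  simp

lemma Dc_pr_pr (i a : Fin (2*n)) : Dc n (pr n i) (pr n a) = Dc n i a := by
  unfold Dc
  simp only [pr_eq, pr_pr]

lemma Kc_pr (i k : Fin (2*n)) : Kc n (pr n k) (pr n i) = Kc n i k := by
  unfold Kc
  rw [bar_pr, bar_pr, eps_pr, eps_pr, show -bar n i - -bar n k = bar n k - bar n i by ring]
  ring

lemma Rm_sym (i a k c : Fin (2*n)) : Rm n (i, a) (k, c) = Rm n (c, k) (a, i) := by
  rw [Rm_eq, Rm_eq]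
  congr 1
  · congr 1
    · by_cases h : i = k ∧ a = c
      · obtain ⟨rfl, rfl⟩ := h
        simp [Dc_comm]
      · rw [if_neg h, if_neg (fun h' => h ⟨h'.2.symm, h'.1.symm⟩)]
    · refine if_congr ?_ rfl rfl
      constructor
      · rintro ⟨h, rfl, rfl⟩; exact ⟨h, rfl, rfl⟩
      · rintro ⟨h, rfl, rfl⟩; exact ⟨h, rfl, rfl⟩
  · by_cases h : i < k ∧ a = pr n i ∧ c = pr n k
    · obtain ⟨h, rfl, rfl⟩ := h
      rw [if_pos ⟨h, rfl, rfl⟩, if_pos ⟨(pr_lt _ _).2 h, (pr_pr _).symm, (pr_pr _).symm⟩, Kc_pr]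
    · rw [if_neg h, if_neg]
      rintro ⟨h1, rfl, rfl⟩
      exact h ⟨(pr_lt _ _).2 h1, (pr_pr _).symm, (pr_pr _).symm⟩

lemma row_sum (i a : Fin (2*n)) (f : Fin (2*n) → Fin (2*n) → F) :
    ∑ k, ∑ c, Rm n (i, a) (k, c) * f k c = Dc n i a * f i a
      + (if i < a then (q - q⁻¹) * f a i else 0)
      - (if a = pr n i then ∑ k, if i < k then Kc n i k * f k (pr n k) else 0 else 0) := by
  simp only [Rm_eq, add_mul, sub_mul, Finset.sum_add_distrib, Finset.sum_sub_distrib, ite_mul,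
    zero_mul, ite_and]
  congr 1
  · congr 1
    · simp
    · by_cases h : i < a <;> simp [h]
  · by_cases h : a = pr n i
    · simp only [h, if_true]
      refine Finset.sum_congr rfl fun k _ => ?_
      by_cases h : i < k <;> simp [h]
    · simp [h]

lemma col_sum (j b : Fin (2*n)) (f : Fin (2*n) → Fin (2*n) → F) :
    ∑ k, ∑ c, f k c * Rm n (k, c) (j, b) = Dc n j b * f j b
      + (if b < j then (q - q⁻¹) * f b j else 0)
      - (if b = pr n j then ∑ k, if k < j then Kc n k j * f k (pr n k) else 0 else 0) := by
  have h : ∀ k c, f k c * Rm n (k, c) (j, b) = Rm n (b, j) (c, k) * f k c := fun k c => by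
    rw [Rm_sym, mul_comm]
  simp only [h]
  rw [Finset.sum_comm, row_sum b j (fun c k => f k c), Dc_comm]
  congr 1
  have e : j = pr n b ↔ b = pr n j := by rw [← pr_eq]; exact eq_comm
  simp only [e]
  split_ifs with hb
  · rw [← Equiv.sum_comp (⟨pr n, pr n, pr_pr, pr_pr⟩ : Fin (2*n) ≃ Fin (2*n))]
    refine Finset.sum_congr rfl fun k _ => ?_
    simp only [Equiv.coe_fn_mk, pr_pr, hb, pr_lt, Kc_pr]
  · rfl

lemma Rm_aux (j k b : Fin (2*n)) : Rm n (j, pr n k) (k, b) =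
    if k = j then (if b = pr n j then q⁻¹ else 0) else 0 := by
  rw [Rm_eq]
  have h2 : ¬ (j < pr n k ∧ k = pr n k ∧ b = j) := fun h => pr_ne k h.2.1.symm
  have h3 : ¬ (j < k ∧ pr n k = pr n j ∧ b = pr n k) := fun h => by
    have := h.2.1
    rw [pr_eq, pr_pr] at this
    exact h.1.ne' this
  rw [if_neg h2, if_neg h3]
  by_cases h : k = j
  · subst h
    simp [Dc_pr, eq_comm]
  · simp [h, Ne.symm h]

lemma Rm_aux' (i k a : Fin (2*n)) : Rm n (k, a) (i, pr n k) =
    if k = i then (if a = pr n i then q⁻¹ else 0) else 0 := by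
  rw [Rm_eq]
  have h2 : ¬ (k < a ∧ i = a ∧ pr n k = k) := fun h => pr_ne k h.2.2
  have h3 : ¬ (k < i ∧ a = pr n k ∧ pr n k = pr n i) := fun h => by
    have := h.2.2
    rw [pr_eq, pr_pr] at this
    exact h.1.ne this
  rw [if_neg h2, if_neg h3]
  by_cases h : k = i
  · subst h
    by_cases h' : a = pr n k
    · subst h'; simp [Dc_pr]
    · simp [h']
  · simp [h]

lemma part1 (i a j b : Fin (2*n)) :
    Dc n i a * (eps n i * Rm n (j, a) (i, b) * eps n b)
      = Dc n j b * (eps n a * Rm n (j, a) (i, b) * eps n j) := by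
  rw [Rm_eq]
  have h1 : Dc n i a * (eps n i * (if j = i ∧ a = b then Dc n j a else 0) * eps n b)
      = Dc n j b * (eps n a * (if j = i ∧ a = b then Dc n j a else 0) * eps n j) := by
    split_ifs with h
    · obtain ⟨rfl, rfl⟩ := h; ring
    · simp
  have h2 : Dc n i a * (eps n i * (if j < a ∧ i = a ∧ b = j then q - q⁻¹ else 0) * eps n b)
      = Dc n j b * (eps n a * (if j < a ∧ i = a ∧ b = j then q - q⁻¹ else 0) * eps n j) := by
    split_ifs with h
    · obtain ⟨_, rfl, rfl⟩ := h
      have : Dc n i i = Dc n b b := by simp [Dc, (pr_ne _).symm]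
      rw [this]
    · simp
  have h3 : Dc n i a * (eps n i * (if j < i ∧ a = pr n j ∧ b = pr n i then Kc n j i else 0) * eps n b)
      = Dc n j b * (eps n a * (if j < i ∧ a = pr n j ∧ b = pr n i then Kc n j i else 0) * eps n j) := by
    split_ifs with h
    · obtain ⟨_, rfl, rfl⟩ := h
      have : Dc n i (pr n j) = Dc n j (pr n i) := by rw [Dc_comm, ← Dc_pr_pr, pr_pr]
      rw [this, eps_pr, eps_pr]
      linear_combination Dc n j (pr n i) * Kc n j i * (eps_sq j - eps_sq i)
    · simp
  linear_combination h1 + h2 - h3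

lemma part2 (i a j b : Fin (2*n)) :
    (if i < a then (q - q⁻¹) * (eps n a * Rm n (j, i) (a, b) * eps n b) else 0)
      = (if b < j then (q - q⁻¹) * (eps n a * Rm n (b, a) (i, j) * eps n b) else 0) := by
  have key : (if i < a then Rm n (j, i) (a, b) else 0)
      = (if b < j then Rm n (b, a) (i, j) else 0) := by
    have h0 : ∀ (p : Prop) [Decidable p] (x y z : F), (if p then x + y - z else 0)
        = (if p then x else 0) + (if p then y else 0) - (if p then z else 0) := by
      intro p _ x y z; split_ifs <;> simp
    rw [Rm_eq, Rm_eq, h0, h0]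
    simp only [← ite_and]
    congr 1
    · congr 1
      · by_cases h : i < a ∧ j = a ∧ i = b
        · obtain ⟨h, rfl, rfl⟩ := h
          rw [if_pos ⟨h, rfl, rfl⟩, if_pos ⟨h, rfl, rfl⟩, Dc_comm]
        · rw [if_neg h, if_neg]
          rintro ⟨h1, rfl, rfl⟩
          exact h ⟨h1, rfl, rfl⟩
      · rw [if_neg, if_neg]
        · rintro ⟨h1, h2, rfl, rfl⟩; exact lt_irrefl _ h1
        · rintro ⟨h1, h2, rfl, rfl⟩; exact lt_irrefl _ h1
    · by_cases h : i < a ∧ j < a ∧ i = pr n j ∧ b = pr n a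
      · have h' := h
        obtain ⟨h1, h2, rfl, rfl⟩ := h
        rw [if_pos h', if_pos, Kc_pr]
        refine ⟨?_, (pr_lt _ _).2 h2, (pr_pr _).symm, (pr_pr _).symm⟩
        rw [← pr_lt, pr_pr]; exact h1
      · rw [if_neg h, if_neg]
        rintro ⟨h1, h2, rfl, rfl⟩
        refine h ⟨?_, ?_, (pr_pr _).symm, (pr_pr _).symm⟩
        · rw [← pr_lt, pr_pr]; exact h1
        · exact (pr_lt _ _).2 h2
  calc _ = (q - q⁻¹) * eps n a * eps n b * (if i < a then Rm n (j, i) (a, b) else 0) := by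
        split_ifs <;> ring
    _ = _ := by rw [key]; split_ifs <;> ring

lemma J_refl (i a j b : Fin (2*n)) :
    ∑ k, ∑ c, Rm n (i, a) (k, c) * eps n k * Rum n (k, c) (j, b) * eps n b
      = ∑ k, ∑ c, eps n a * Rum n (i, a) (k, c) * eps n k * Rm n (k, c) (j, b) := by
  have hl := row_sum i a (fun k c => eps n k * Rm n (j, c) (k, b) * eps n b)
  have hr := col_sum j b (fun k c => eps n a * Rm n (k, a) (i, c) * eps n k)
  simp only [Rum]
  simp only [← mul_assoc] at hl hr ⊢
  rw [hl, hr]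
  simp only [mul_assoc]
  have p1 := part1 i a j b
  have p2 := part2 i a j b
  simp only [mul_assoc] at p1 p2
  rw [p1, p2]
  congr 1
  simp only [Rm_aux, Rm_aux']
  by_cases ha : a = pr n i
  · by_cases hb : b = pr n j
    · subst ha hb
      simp only [if_true]
      rw [Finset.sum_eq_single j, Finset.sum_eq_single i]
      · by_cases h : i < j
        · simp only [h, if_true, eps_pr]
          linear_combination (Kc n i j * q⁻¹) * (eps_sq i - eps_sq j)
        · simp [h]
      · intro k _ hk; simp [hk]
      · simp
      · intro k _ hk; simp [hk]
      · simp
    · simp [hb]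
  · simp [ha]

end Scalars

/-- the matrix S = T J T̄^u is lower triangular with diagonal entries ε_i,
    satisfies the reflection equation R S₁ R^u S₂ = S₂ R^u S₁ R (entrywise), and
    satisfies S̄ D⁻¹ S D = −I. -/
theorem S_relations (n : ℕ) (hn : 2 ≤ n) :
    (∀ i j : Fin (2*n), i < j → sU n i j = 0) ∧
    (∀ i : Fin (2*n), sU n i i = eps n i • (1 : Usp n)) ∧
    (∀ i a j b : Fin (2*n),
        ∑ k, ∑ c, ∑ l, ∑ e, (Rm n (i, a) (k, c) * Rum n (l, c) (j, e)) •
            (sU n k l * sU n e b)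
          = ∑ c, ∑ l, ∑ d, ∑ m, (Rum n (i, c) (l, d) * Rm n (m, d) (j, b)) •
              (sU n a c * sU n l m)) ∧
    (∀ i j : Fin (2*n),
        ∑ k, ((dd n k)⁻¹ * dd n j) • (sbU n i k * sU n k j)
          = if i = j then -(1 : Usp n) else 0) := by
  have tup : ∀ i j : Fin (2*n), i < j → tU n i j = 0 := fun i j h => by
    simpa [tU] using RingQuot.mkAlgHom_rel F (rel.t_upper i j h)
  have tblo : ∀ i j : Fin (2*n), j < i → tbU n i j = 0 := fun i j h => by
    simpa [tbU] using RingQuot.mkAlgHom_rel F (rel.tb_lower i j h)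
  have sfull : ∀ i j : Fin (2*n), sU n i j = ∑ k, eps n k • (tU n i k * tbU n j k) := by
    intro i j
    refine Finset.sum_subset (Finset.subset_univ _) fun k _ hk => ?_
    simp only [Finset.mem_Icc, not_and_or, not_le] at hk
    rcases hk with hk | hk
    · rw [tblo _ _ hk, mul_zero, smul_zero]
    · rw [tup _ _ hk, zero_mul, smul_zero]
  have sbfull : ∀ i j : Fin (2*n), sbU n i j = (eps n i * eps n j) • ∑ k,
      eps n (pr n k) • (tbU n (pr n i) (pr n k) * tU n (pr n j) (pr n k)) := by
    intro i j
    unfold sbU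
    congr 1
    refine Finset.sum_subset (Finset.subset_univ _) fun k _ hk => ?_
    simp only [Finset.mem_Icc, not_and_or, not_le] at hk
    rcases hk with hk | hk
    · rw [tup _ _ ((pr_lt _ _).2 hk), mul_zero, smul_zero]
    · rw [tblo _ _ ((pr_lt _ _).2 hk), zero_mul, smul_zero]
  refine ⟨fun i j h => ?_, fun i => ?_, fun i a j b => ?_, fun i j => ?_⟩
  · unfold sU
    rw [Finset.Icc_eq_empty (not_le.2 h), Finset.sum_empty]
  · unfold sU
    rw [Finset.Icc_self, Finset.sum_singleton]
    congr 1
    simpa [tU, tbU] using RingQuot.mkAlgHom_rel F (rel.t_tb_diag i)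
  · have key := reflection (Rm n) (Rum n) (eps n) (Matrix.of (tU n)) (Matrix.of (tbU n))
      (fun _ _ => rfl) Rm_sym
      (fun i a j b => by
        simpa [tU, tbU] using RingQuot.mkAlgHom_rel F (rel.rtt_tt i a j b))
      (fun i a j b => by
        simpa [tU, tbU] using RingQuot.mkAlgHom_rel F (rel.rtt_bb i a j b))
      (fun i a j b => by
        simpa [tU, tbU] using RingQuot.mkAlgHom_rel F (rel.rtt_bt i a j b))
      J_refl (Matrix.of (sU n)) (by
        ext i j
        rw [Matrix.of_apply, sfull, Matrix.mul_apply]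
        refine Finset.sum_congr rfl fun k _ => ?_
        rw [Matrix.mul_diagonal, Matrix.of_apply, Matrix.transpose_apply, Matrix.of_apply,
          ← Algebra.commutes, mul_assoc, Algebra.smul_def])
    have := congrFun (congrFun key (i, a)) (j, b)
    rw [lhs_entry, rhs_entry] at this
    simpa only [Matrix.of_apply] using this
  · have ct : ∀ i j : Fin (2*n), ∑ k, (dd n i * (dd n k)⁻¹ * eps n (pr n i) * eps n (pr n k)) •
        (tU n (pr n k) (pr n i) * tU n k j) = if i = j then 1 else 0 := by
      intro i j
      have := RingQuot.mkAlgHom_rel F (rel.cent_t2 i j)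
      rw [apply_ite (RingQuot.mkAlgHom F (rel n))] at this
      simp only [map_sum, map_smul, map_mul, map_one, map_zero] at this
      exact this
    have ctb : ∀ i j : Fin (2*n), ∑ k, (dd n k * (dd n j)⁻¹ * eps n (pr n k) * eps n (pr n j)) •
        (tbU n i k * tbU n (pr n j) (pr n k)) = if i = j then 1 else 0 := by
      intro i j
      have := RingQuot.mkAlgHom_rel F (rel.cent_tb1 i j)
      rw [apply_ite (RingQuot.mkAlgHom F (rel n))] at this
      simp only [map_sum, map_smul, map_mul, map_one, map_zero] at this
      exact this
    have step : ∀ k, ((dd n k)⁻¹ * dd n j) • (sbU n i k * sU n k j)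
        = ∑ l, ∑ m, ((-(eps n i * dd n j * (dd n l)⁻¹ * eps n m)) •
          (tbU n (pr n i) (pr n l) *
          ((dd n l * (dd n k)⁻¹ * eps n (pr n l) * eps n (pr n k)) •
            (tU n (pr n k) (pr n l) * tU n k m)) * tbU n j m) : Usp n) := by
      intro k
      rw [sbfull, sfull, smul_mul_assoc, Finset.sum_mul, Finset.smul_sum, Finset.smul_sum]
      refine Finset.sum_congr rfl fun l _ => ?_
      rw [Finset.mul_sum, Finset.smul_sum, Finset.smul_sum]
      refine Finset.sum_congr rfl fun m _ => ?_
      simp only [smul_mul_assoc, mul_smul_comm, smul_smul, mul_assoc, eps_pr]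
      congr 1
      have := dd_ne l
      field_simp
    rw [Finset.sum_congr rfl fun k _ => step k, Finset.sum_comm]
    have step2 : ∀ l, ∑ k, ∑ m, ((-(eps n i * dd n j * (dd n l)⁻¹ * eps n m)) •
          (tbU n (pr n i) (pr n l) *
          ((dd n l * (dd n k)⁻¹ * eps n (pr n l) * eps n (pr n k)) •
            (tU n (pr n k) (pr n l) * tU n k m)) * tbU n j m) : Usp n)
        = (-(eps n i * dd n j * (dd n l)⁻¹ * eps n l)) • (tbU n (pr n i) (pr n l) * tbU n j l) := by
      intro l
      rw [Finset.sum_comm]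
      rw [Finset.sum_eq_single l]
      · rw [← Finset.smul_sum, ← Finset.sum_mul, ← Finset.mul_sum, ct l l,
          if_pos rfl, mul_one]
      · intro m _ hm
        rw [← Finset.smul_sum, ← Finset.sum_mul, ← Finset.mul_sum, ct l m,
          if_neg (Ne.symm hm), mul_zero, zero_mul, smul_zero]
      · simp
    rw [Finset.sum_congr rfl fun l _ => step2 l]
    have h := ctb (pr n i) (pr n j)
    rw [← Equiv.sum_comp (⟨pr n, pr n, pr_pr, pr_pr⟩ : Fin (2*n) ≃ Fin (2*n))] at h
    simp only [Equiv.coe_fn_mk, pr_pr, dd_pr, inv_inv] at h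
    have h' : ∑ l, (-(eps n i * dd n j * (dd n l)⁻¹ * eps n l)) •
        (tbU n (pr n i) (pr n l) * tbU n j l) = (-(eps n i * eps n j)) •
        (if pr n i = pr n j then (1 : Usp n) else 0) := by
      rw [← h, Finset.smul_sum]
      refine Finset.sum_congr rfl fun l _ => ?_
      rw [smul_smul]
      congr 1
      linear_combination ((eps n i * dd n j * (dd n l)⁻¹ * eps n l)) * eps_sq j
    rw [h']
    by_cases hij : i = j
    · subst hij
      rw [if_pos rfl, if_pos rfl, eps_sq]
      exact neg_one_smul_one F (Usp n)
    · have : pr n i ≠ pr n j := fun h => hij (by rw [← pr_pr i, h, pr_pr])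
      rw [if_neg this, if_neg hij, smul_zero]

end CI
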